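/- The group of ℂ-algebra automorphisms of A = ℂ[x,y,z]/(x⁵ + y³ + z²) is isomorphic, as a group, to ℂ*; an isomorphism is induced by sending t ∈ ℂ* to the diagonal automorphism x ↦ t⁶x, y ↦ t¹⁰y, z ↦ t¹⁵z. -/

import Mathlib

open MvPolynomial

noncomputable section

/-- The ideal (x⁵ + y³ + z²) in ℂ[x,y,z]. -/
def Ie8 : Ideal (MvPolynomial (Fin 3) ℂ) :=
  Ideal.span {(X 0 ^ 5 + X 1 ^ 3 + X 2 ^ 2 : MvPolynomial (Fin 3) ℂ)}

/-- The coordinate ring A = ℂ[x,y,z]/(x⁵ + y³ + z²) of the Klein surface. -/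
abbrev Ae8 : Type := MvPolynomial (Fin 3) ℂ ⧸ Ie8

namespace Derivation

section LocallyNilpotent

variable {K A : Type*} [Field K] [CommRing A] [Algebra K A]

/-- A derivation is locally nilpotent if every element is killed by one of its iterates. -/
def IsLocallyNilpotent (D : Derivation K A A) : Prop :=
  ∀ a, ∃ n, D^[n] a = 0

/-- `D.HasNilDegree a n` says that `n` is the largest exponent for which `D^[n] a ≠ 0`. -/
def HasNilDegree (D : Derivation K A A) (a : A) (n : ℕ) : Prop :=
  D^[n] a ≠ 0 ∧ D^[n + 1] a = 0

variable {D : Derivation K A A} {a b : A} {m n : ℕ}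

lemma iterate_eq_zero_of_le (h : D^[m] a = 0) (hmn : m ≤ n) : D^[n] a = 0 := by
  obtain ⟨k, rfl⟩ := Nat.exists_eq_add_of_le' hmn
  rw [Function.iterate_add_apply, h, iterate_map_zero]

lemma iterate_mul_of_iterate_eq_zero (ha : D^[m + 1] a = 0) (hb : D^[n + 1] b = 0) :
    D^[m + n] (a * b) = (m + n).choose m * (D^[m] a * D^[n] b) ∧ D^[m + n + 1] (a * b) = 0 := by
  suffices H : D^[m + n] (a * b) = (m + n).choose m * (D^[m] a * D^[n] b) by
    refine ⟨H, ?_⟩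
    rw [Function.iterate_succ_apply'] at ha hb ⊢
    simp [H, ha, hb]
  induction hs : m + n generalizing m n a b with
  | zero =>
    obtain ⟨rfl, rfl⟩ : m = 0 ∧ n = 0 := by omega
    simp
  | succ s ih =>
    rw [Function.iterate_succ_apply, leibniz, iterate_map_add, smul_eq_mul, smul_eq_mul,
      mul_comm b]
    rcases m with _ | m <;> rcases n with _ | n
    · omega
    · have ha' : D a = 0 := ha
      rw [ih (a := a) (b := D b) (m := 0) (n := n) ha hb (by omega)]
      simp [ha', iterate_map_zero]
    · have hb' : D b = 0 := hb
      rw [ih (a := D a) (b := b) (m := m) (n := 0) ha hb (by omega)]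
      obtain rfl : s = m := by omega
      simp [hb', iterate_map_zero]
    · rw [ih (m := m + 1) (n := n) ha hb (by omega), ih (m := m) (n := n + 1) ha hb (by omega),
        Nat.choose_succ_succ]
      simp only [Function.iterate_succ_apply]
      push_cast
      ring

lemma IsLocallyNilpotent.exists_hasNilDegree (hD : D.IsLocallyNilpotent) (ha : a ≠ 0) :
    ∃ n, D.HasNilDegree a n := by
  classical
  obtain ⟨n, hn⟩ : ∃ n, Nat.find (hD a) = n + 1 :=
    Nat.exists_eq_succ_of_ne_zero fun h => ha (by simpa [h] using Nat.find_spec (hD a))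
  exact ⟨n, Nat.find_min (hD a) (by omega), hn ▸ Nat.find_spec (hD a)⟩

lemma HasNilDegree.unique (hm : D.HasNilDegree a m) (hn : D.HasNilDegree a n) : m = n := by
  by_contra h
  rcases lt_or_gt_of_ne h with h | h
  · exact hn.1 (iterate_eq_zero_of_le hm.2 h)
  · exact hm.1 (iterate_eq_zero_of_le hn.2 h)

variable [CharZero K] [IsDomain A]

lemma HasNilDegree.mul (ha : D.HasNilDegree a m) (hb : D.HasNilDegree b n) :
    D.HasNilDegree (a * b) (m + n) := by
  obtain ⟨h, h'⟩ := iterate_mul_of_iterate_eq_zero ha.2 hb.2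
  have : CharZero A := charZero_of_injective_algebraMap (algebraMap K A).injective
  refine ⟨?_, h'⟩
  rw [h]
  exact mul_ne_zero (Nat.cast_ne_zero.2 (Nat.choose_pos (by omega)).ne')
    (mul_ne_zero ha.1 hb.1)

lemma IsLocallyNilpotent.hasNilDegree_le_of_dvd (hD : D.IsLocallyNilpotent) (hab : a ∣ b)
    (ha : D.HasNilDegree a m) (hb : D.HasNilDegree b n) : m ≤ n := by
  obtain ⟨c, rfl⟩ := hab
  have hc : c ≠ 0 := by
    rintro rfl
    exact hb.1 (by rw [mul_zero, iterate_map_zero])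
  obtain ⟨k, hk⟩ := hD.exists_hasNilDegree hc
  exact (ha.mul hk).unique hb ▸ Nat.le_add_right m k

/-- The kernel of a locally nilpotent derivation is factorially closed. -/
lemma IsLocallyNilpotent.apply_eq_zero_of_dvd (hD : D.IsLocallyNilpotent) (hab : a ∣ b)
    (hb : b ≠ 0) (h : D b = 0) : D a = 0 := by
  obtain ⟨m, hm⟩ := hD.exists_hasNilDegree (ne_zero_of_dvd_ne_zero hb hab)
  obtain rfl : m = 0 := Nat.le_zero.1 (hD.hasNilDegree_le_of_dvd hab hm ⟨hb, h⟩)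
  exact hm.2

lemma IsLocallyNilpotent.lt_of_dvd_mul_apply (hD : D.IsLocallyNilpotent) {c : A} (hc : c ≠ 0)
    (hDc : D c = 0) (hDb : D b ≠ 0) (hab : a ∣ c * D b)
    (ha : D.HasNilDegree a m) (hb : D.HasNilDegree b n) : m < n := by
  obtain ⟨k, rfl⟩ : ∃ k, n = k + 1 := by
    refine Nat.exists_eq_succ_of_ne_zero ?_
    rintro rfl
    exact hDb hb.2
  have hc' : D.HasNilDegree c 0 := ⟨hc, hDc⟩
  have hb' : D.HasNilDegree (D b) k := hb
  have := hD.hasNilDegree_le_of_dvd hab ha (hc'.mul hb')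
  omega

/-- If a locally nilpotent derivation kills a nonzero binomial `a ^ (p + 2) + r b ^ (q + 2)`, then
it kills `a` and `b`. -/
lemma IsLocallyNilpotent.apply_eq_zero_of_binomial (hD : D.IsLocallyNilpotent) {r : K} {p q : ℕ}
    (hr : r ≠ 0) (hne : a ^ (p + 2) + r • b ^ (q + 2) ≠ 0)
    (h : D (a ^ (p + 2) + r • b ^ (q + 2)) = 0) : D a = 0 ∧ D b = 0 := by
  have : CharZero A := charZero_of_injective_algebraMap (algebraMap K A).injective
  set s : A := algebraMap K A r with hs
  have hs0 : s ≠ 0 := (map_ne_zero_iff _ (algebraMap K A).injective).2 hr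
  have hp0 : ((p + 2 : ℕ) : A) ≠ 0 := Nat.cast_ne_zero.2 (by omega)
  have hq0 : ((q + 2 : ℕ) : A) ≠ 0 := Nat.cast_ne_zero.2 (by omega)
  have hDnat : ∀ n : ℕ, D (n : A) = 0 := fun n => D.map_natCast n
  have hDs : D s = 0 := D.map_algebraMap r
  have key : (p + 2 : ℕ) * (a ^ (p + 1) * D a) + s * ((q + 2 : ℕ) * (b ^ (q + 1) * D b)) = 0 := by
    simpa [leibniz_pow, Algebra.smul_def, ← hs, hDs, mul_assoc] using h
  rw [Algebra.smul_def, ← hs] at h hne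
  by_cases ha : D a = 0
  · refine ⟨ha, ?_⟩
    rw [ha, mul_zero, mul_zero, zero_add] at key
    rcases mul_eq_zero.1 ((mul_eq_zero.1 ((mul_eq_zero.1 key).resolve_left hs0)).resolve_left hq0)
      with hb | hb
    · rw [pow_eq_zero_iff (by omega)] at hb
      simp [hb]
    · exact hb
  by_cases hb : D b = 0
  · refine ⟨?_, hb⟩
    rw [hb, mul_zero, mul_zero, mul_zero, add_zero] at key
    rcases mul_eq_zero.1 ((mul_eq_zero.1 key).resolve_left hp0) with ha | ha
    · rw [pow_eq_zero_iff (by omega)] at ha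
      simp [ha]
    · exact ha
  exfalso
  obtain ⟨m, hm⟩ := hD.exists_hasNilDegree (a := a) (by rintro rfl; simp at ha)
  obtain ⟨n, hn⟩ := hD.exists_hasNilDegree (a := b) (by rintro rfl; simp at hb)
  refine lt_asymm
    (hD.lt_of_dvd_mul_apply (c := (q + 2 : ℕ) * (a ^ (p + 2) + s * b ^ (q + 2)))
      (mul_ne_zero hq0 hne) (by simp [-Nat.cast_add, h, hDnat]) hb
      ⟨(q + 2 : ℕ) * (a ^ (p + 1) * D b) - (p + 2 : ℕ) * (a ^ p * b * D a), ?_⟩ hm hn)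
    (hD.lt_of_dvd_mul_apply (c := (p + 2 : ℕ) * (a ^ (p + 2) + s * b ^ (q + 2)))
      (mul_ne_zero hp0 hne) (by simp [-Nat.cast_add, h, hDnat]) ha
      ⟨s * ((p + 2 : ℕ) * (b ^ (q + 1) * D a) - (q + 2 : ℕ) * (b ^ q * a * D b)), ?_⟩ hn hm)
  · linear_combination b * key
  · linear_combination a * key

end LocallyNilpotent

end Derivation

namespace GradedAlgebra

open DirectSum

variable {K A : Type*} [Field K] [CommRing A] [Algebra K A]
variable {𝒜 : ℤ → Submodule K A} [GradedAlgebra 𝒜]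

lemma proj_mem (n : ℤ) (a : A) : proj 𝒜 n a ∈ 𝒜 n :=
  (decompose 𝒜 a n).2

lemma proj_of_mem {n : ℤ} {a : A} (ha : a ∈ 𝒜 n) : proj 𝒜 n a = a :=
  decompose_of_mem_same 𝒜 ha

lemma proj_of_mem_ne {m n : ℤ} {a : A} (ha : a ∈ 𝒜 m) (h : m ≠ n) :
    proj 𝒜 n a = 0 :=
  decompose_of_mem_ne 𝒜 ha h

lemma exists_sum_proj (a : A) : ∃ s : Finset ℤ, (∀ n, proj 𝒜 n a ≠ 0 → n ∈ s) ∧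
    ∑ n ∈ s, proj 𝒜 n a = a := by
  classical
  exact ⟨(decompose 𝒜 a).support, fun n hn => (mem_support_iff 𝒜 a n).2 hn,
    sum_support_decompose 𝒜 a⟩

lemma eq_of_proj_eq {a b : A} (h : ∀ n, proj 𝒜 n a = proj 𝒜 n b) :
    a = b :=
  (decompose 𝒜).injective (DFinsupp.ext fun n => Subtype.ext (h n))

lemma mem_of_proj_eq_zero {a : A} {n : ℤ} (h : ∀ m ≠ n, proj 𝒜 m a = 0) :
    a ∈ 𝒜 n := by
  have : a = proj 𝒜 n a := by
    refine eq_of_proj_eq (𝒜 := 𝒜) fun m => ?_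
    rcases eq_or_ne m n with rfl | hm
    · exact (proj_of_mem (proj_mem _ _)).symm
    · rw [h m hm, proj_of_mem_ne (proj_mem _ _) hm.symm]
  exact this ▸ proj_mem n a

end GradedAlgebra

namespace Derivation

section Graded

open DirectSum GradedAlgebra

variable {K A : Type*} [Field K] [CommRing A] [Algebra K A]
variable (𝒜 : ℤ → Submodule K A) [GradedAlgebra 𝒜]

/-- The derivation of a graded algebra that acts on the piece of degree `n` by `f n`, where the
maps `f n` satisfy the Leibniz rule on homogeneous elements. -/
noncomputable def ofGraded (f : ℤ → A →ₗ[K] A)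
    (hf : ∀ m n, ∀ a ∈ 𝒜 m, ∀ b ∈ 𝒜 n, f (m + n) (a * b) = a * f n b + b * f m a) :
    Derivation K A A :=
  have key {n : ℤ} {a : A} (ha : a ∈ 𝒜 n) :
      (toModule K ℤ A (fun n => f n ∘ₗ (𝒜 n).subtype) ∘ₗ
        (decomposeLinearEquiv 𝒜).toLinearMap) a = f n a := by
    rw [LinearMap.comp_apply, LinearEquiv.coe_coe, decomposeLinearEquiv_apply,
      decompose_of_mem 𝒜 ha, ← lof_eq_of K, toModule_lof]
    rfl
  Derivation.mk' (toModule K ℤ A (fun n => f n ∘ₗ (𝒜 n).subtype) ∘ₗ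
      (decomposeLinearEquiv 𝒜).toLinearMap) <| by
    refine Decomposition.inductionOn 𝒜 (by simp) ?_ ?_
    · rintro m ⟨a, ha⟩
      refine Decomposition.inductionOn 𝒜 (by simp) ?_ ?_
      · rintro n ⟨b, hb⟩
        rw [key (SetLike.mul_mem_graded ha hb), key ha, key hb]
        exact hf m n a ha b hb
      · intro b c hb hc
        rw [mul_add, map_add, hb, hc, map_add]
        simp only [smul_eq_mul]
        ring
    · intro b c hb hc a
      rw [add_mul, map_add, hb, hc, map_add]
      simp only [smul_eq_mul]
      ring

variable {𝒜}

lemma ofGraded_apply {f : ℤ → A →ₗ[K] A}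
    {hf : ∀ m n, ∀ a ∈ 𝒜 m, ∀ b ∈ 𝒜 n, f (m + n) (a * b) = a * f n b + b * f m a}
    {n : ℤ} {a : A} (ha : a ∈ 𝒜 n) : ofGraded 𝒜 f hf a = f n a := by
  change toModule K ℤ A (fun n => f n ∘ₗ (𝒜 n).subtype) (decomposeLinearEquiv 𝒜 a) = f n a
  rw [decomposeLinearEquiv_apply, decompose_of_mem 𝒜 ha, ← lof_eq_of K, toModule_lof]
  rfl

variable (𝒜)

/-- The Euler derivation, which multiplies homogeneous elements by their degree. -/
noncomputable def euler : Derivation K A A :=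
  ofGraded 𝒜 (fun n => (n : K) • LinearMap.id) <| by
    intro m n a _ b _
    simp only [LinearMap.smul_apply, LinearMap.id_apply]
    simp only [Algebra.smul_def]
    push_cast
    ring

/-- The homogeneous component of degree `k` of a derivation. -/
noncomputable def component (D : Derivation K A A) (k : ℤ) : Derivation K A A :=
  ofGraded 𝒜 (fun n => proj 𝒜 (n + k) ∘ₗ D.toLinearMap) <| by
    intro m n a ha b hb
    simp only [LinearMap.comp_apply, coeFn_coe, leibniz, map_add, smul_eq_mul,
      GradedAlgebra.proj_apply]
    congr 1
    · rw [add_assoc, coe_decompose_mul_add_of_left_mem 𝒜 ha]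
    · rw [add_comm m n, add_assoc, coe_decompose_mul_add_of_left_mem 𝒜 hb]

variable {𝒜}

lemma euler_apply {n : ℤ} {a : A} (ha : a ∈ 𝒜 n) : euler 𝒜 a = (n : K) • a :=
  ofGraded_apply ha

lemma component_apply (D : Derivation K A A) (k : ℤ) {n : ℤ} {a : A} (ha : a ∈ 𝒜 n) :
    component 𝒜 D k a = proj 𝒜 (n + k) (D a) :=
  ofGraded_apply ha

lemma component_apply_mem (D : Derivation K A A) (k : ℤ) {n : ℤ} {a : A} (ha : a ∈ 𝒜 n) :
    component 𝒜 D k a ∈ 𝒜 (n + k) :=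
  component_apply D k ha ▸ proj_mem _ _

lemma exists_mem_of_euler_apply_eq [CharZero K] {c : K} {a : A} (ha : a ≠ 0)
    (h : euler 𝒜 a = c • a) : ∃ n : ℤ, c = n ∧ a ∈ 𝒜 n := by
  have hproj (n : ℤ) : proj 𝒜 n (euler 𝒜 a) = (n : K) • proj 𝒜 n a := by
    clear h ha
    induction a using Decomposition.inductionOn 𝒜 with
    | zero => simp
    | homogeneous a =>
      rename_i m
      rw [euler_apply a.2, _root_.map_smul]
      rcases eq_or_ne m n with rfl | hm
      · rfl
      · simp only [proj_of_mem_ne a.2 hm, smul_zero]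
    | add a b ha hb => simp only [map_add, smul_add, ha, hb]
  have hc (n : ℤ) : (n : K) = c ∨ proj 𝒜 n a = 0 := by
    have := hproj n
    rw [h, _root_.map_smul, ← sub_eq_zero, ← sub_smul, smul_eq_zero, sub_eq_zero] at this
    exact this.imp_left Eq.symm
  obtain ⟨n, hn⟩ : ∃ n, proj 𝒜 n a ≠ 0 := by
    by_contra! H
    exact ha (eq_of_proj_eq (𝒜 := 𝒜) fun n => by rw [H n, map_zero])
  obtain rfl := (hc n).resolve_right hn
  refine ⟨n, rfl, mem_of_proj_eq_zero fun m hm => (hc m).resolve_left ?_⟩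
  exact_mod_cast hm

lemma proj_apply_eq_sum (D : Derivation K A A) (a : A) (s : Finset ℤ)
    (hs : ∑ j ∈ s, proj 𝒜 j a = a) (i : ℤ) :
    proj 𝒜 i (D a) =
      ∑ j ∈ s, component 𝒜 D (i - j) (proj 𝒜 j a) := by
  conv_lhs => rw [← hs, map_sum, map_sum]
  refine Finset.sum_congr rfl fun j _ => ?_
  rw [component_apply _ _ (proj_mem j a), add_sub_cancel]

lemma proj_iterate (D : Derivation K A A) {d : ℤ} (hd : ∀ j, d < j → component 𝒜 D j = 0)
    {n : ℤ} {a : A} (ha : a ∈ 𝒜 n) (m : ℕ) :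
    (∀ j, n + m * d < j → proj 𝒜 j (D^[m] a) = 0) ∧
      proj 𝒜 (n + m * d) (D^[m] a) = (component 𝒜 D d)^[m] a := by
  induction m with
  | zero =>
    simp only [Nat.cast_zero, zero_mul, add_zero, Function.iterate_zero, id]
    exact ⟨fun j hj => proj_of_mem_ne ha hj.ne, proj_of_mem ha⟩
  | succ m ih =>
    obtain ⟨s, hs, hsum⟩ := exists_sum_proj (𝒜 := 𝒜) (D^[m] a)
    simp only [Function.iterate_succ_apply', proj_apply_eq_sum D _ s hsum]
    push_cast
    have hzero {i j : ℤ} (hi : n + (m + 1) * d ≤ i) (hij : n + (m + 1) * d < i ∨ j ≠ n + m * d) :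
        component 𝒜 D (i - j) (proj 𝒜 j (D^[m] a)) = 0 := by
      rcases lt_or_ge (n + m * d) j with hj | hj
      · rw [ih.1 j hj, map_zero]
      · rw [hd, coe_zero, Pi.zero_apply]
        rcases hij with h | h
        · linarith
        · linarith [lt_of_le_of_ne hj h]
    refine ⟨fun i hi => Finset.sum_eq_zero fun j _ => hzero hi.le (.inl hi), ?_⟩
    rw [Finset.sum_eq_single (n + m * d) (fun j _ hj => hzero le_rfl (.inr hj)), ih.2]
    · congr 2
      ring
    · intro h
      rw [not_imp_comm.1 (hs _) h, map_zero]

lemma isLocallyNilpotent_of_homogeneous {D : Derivation K A A}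
    (h : ∀ n, ∀ a ∈ 𝒜 n, ∃ m, D^[m] a = 0) : D.IsLocallyNilpotent := by
  intro a
  induction a using Decomposition.inductionOn 𝒜 with
  | zero => exact ⟨0, rfl⟩
  | homogeneous a => exact h _ a a.2
  | add a b ha hb =>
    obtain ⟨m, hm⟩ := ha
    obtain ⟨n, hn⟩ := hb
    exact ⟨max m n, by rw [iterate_map_add, iterate_eq_zero_of_le hm (le_max_left _ _),
      iterate_eq_zero_of_le hn (le_max_right _ _), add_zero]⟩

/-- The top component of a derivation with bounded orbits is locally nilpotent if it has positive
degree. -/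
lemma isLocallyNilpotent_component (D : Derivation K A A) {d : ℤ} (hd0 : 0 < d)
    (hd : ∀ j, d < j → component 𝒜 D j = 0)
    (hfin : ∀ a, ∃ N : ℤ, ∀ m : ℕ, ∀ j, N < j → proj 𝒜 j (D^[m] a) = 0) :
    (component 𝒜 D d).IsLocallyNilpotent := by
  refine isLocallyNilpotent_of_homogeneous (𝒜 := 𝒜) fun n a ha => ?_
  obtain ⟨N, hN⟩ := hfin a
  refine ⟨(N - n).toNat + 1, ?_⟩
  rw [← (proj_iterate D hd ha _).2]
  refine hN _ _ ?_
  have := Int.self_le_toNat (N - n)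
  push_cast
  nlinarith

/-- A homogeneous derivation of negative degree is locally nilpotent if the grading is
nonnegative. -/
lemma isLocallyNilpotent_of_neg (hneg : ∀ n < 0, 𝒜 n = ⊥) (D : Derivation K A A) {k : ℤ}
    (hk : k < 0) (hD : ∀ n, ∀ a ∈ 𝒜 n, D a ∈ 𝒜 (n + k)) : D.IsLocallyNilpotent := by
  have hmem {n : ℤ} {a : A} (ha : a ∈ 𝒜 n) (m : ℕ) : D^[m] a ∈ 𝒜 (n + m * k) := by
    induction m with
    | zero => simpa using ha
    | succ m ih =>
      rw [Function.iterate_succ_apply']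
      convert hD _ _ ih using 1
      push_cast
      ring_nf
  refine isLocallyNilpotent_of_homogeneous (𝒜 := 𝒜) fun n a ha => ?_
  refine ⟨n.toNat + 1, ?_⟩
  have h := hmem ha (n.toNat + 1)
  rwa [hneg, Submodule.mem_bot] at h
  have := Int.self_le_toNat n
  push_cast
  nlinarith

/-- The conjugate of a derivation by an automorphism. -/
def conj (φ : A ≃ₐ[K] A) (D : Derivation K A A) : Derivation K A A :=
  Derivation.mk' (φ.toLinearMap ∘ₗ D.toLinearMap ∘ₗ φ.symm.toLinearMap) fun a b => by simp

lemma conj_apply (φ : A ≃ₐ[K] A) (D : Derivation K A A) (a : A) :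
    conj φ D a = φ (D (φ.symm a)) :=
  rfl

lemma conj_euler_bounded (φ : A ≃ₐ[K] A) (a : A) :
    ∃ N : ℤ, ∀ m : ℕ, ∀ j, N < j →
      proj 𝒜 j ((conj φ (euler 𝒜))^[m] a) = 0 := by
  obtain ⟨b, rfl⟩ := φ.surjective a
  induction b using Decomposition.inductionOn 𝒜 with
  | zero => exact ⟨0, fun m j _ => by simp⟩
  | homogeneous b =>
    rename_i n
    have hit (m : ℕ) : (conj φ (euler 𝒜))^[m] (φ b) = (n : K) ^ m • φ b := by
      induction m with
      | zero => simp
      | succ m ih =>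
        rw [Function.iterate_succ_apply', ih, Derivation.map_smul, conj_apply, φ.symm_apply_apply,
          euler_apply b.2, _root_.map_smul, smul_smul, pow_succ]
    obtain ⟨s, hs, -⟩ := exists_sum_proj (𝒜 := 𝒜) (φ b)
    obtain ⟨N, hN⟩ := s.bddAbove
    refine ⟨N, fun m j hj => ?_⟩
    rw [hit, _root_.map_smul, not_imp_comm.1 (hs j) fun h => (hN h).not_gt hj, smul_zero]
  | add b c hb hc =>
    obtain ⟨M, hM⟩ := hb
    obtain ⟨N, hN⟩ := hc
    refine ⟨max M N, fun m j hj => ?_⟩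
    rw [map_add, iterate_map_add, map_add, hM m j ((le_max_left _ _).trans_lt hj),
      hN m j ((le_max_right _ _).trans_lt hj), add_zero]

/-- If a nonnegatively graded algebra that is generated by finitely many homogeneous elements has no
nontrivial homogeneous locally nilpotent derivations, then every conjugate of its Euler derivation
is homogeneous of degree zero. -/
lemma conj_euler_apply_mem (hneg : ∀ n < 0, 𝒜 n = ⊥)
    (hrigid : ∀ (k : ℤ) (D : Derivation K A A), (∀ n, ∀ a ∈ 𝒜 n, D a ∈ 𝒜 (n + k)) →
      D.IsLocallyNilpotent → D = 0)
    {s : Set A} (hs : s.Finite) (hgen : Algebra.adjoin K s = ⊤)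
    (hhom : ∀ a ∈ s, ∃ n, a ∈ 𝒜 n) (φ : A ≃ₐ[K] A) {n : ℤ} {a : A} (ha : a ∈ 𝒜 n) :
    conj φ (euler 𝒜) a ∈ 𝒜 n := by
  set D := conj φ (euler 𝒜)
  have hneg' {k : ℤ} (hk : k < 0) : component 𝒜 D k = 0 :=
    have h n a (ha : a ∈ 𝒜 n) := component_apply_mem (𝒜 := 𝒜) D k ha
    hrigid k _ h (isLocallyNilpotent_of_neg hneg _ hk h)
  obtain ⟨N, hN⟩ : ∃ N : ℤ, ∀ k, N < k → component 𝒜 D k = 0 := by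
    have hb (a : A) : ∃ N : ℤ, a ∈ s → ∀ k, N < k → component 𝒜 D k a = 0 := by
      by_cases h : a ∈ s
      · obtain ⟨n, hn⟩ := hhom a h
        obtain ⟨N, hN⟩ := conj_euler_bounded (𝒜 := 𝒜) φ a
        refine ⟨N - n, fun _ k hk => ?_⟩
        rw [component_apply D k hn]
        exact hN 1 _ (by linarith)
      · exact ⟨0, fun h' => absurd h' h⟩
    choose f hf using hb
    obtain ⟨N, hN⟩ := (hs.image f).bddAbove
    refine ⟨N, fun k hk => Derivation.ext_of_adjoin_eq_top s hgen fun a ha => ?_⟩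
    exact hf a ha k ((hN (Set.mem_image_of_mem f ha)).trans_lt hk)
  have hpos (m : ℕ) (hm : m ≤ N.toNat) {k : ℤ} (hk : (N.toNat - m : ℤ) < k) :
      component 𝒜 D k = 0 := by
    induction m generalizing k with
    | zero => exact hN k (by have := Int.self_le_toNat N; push_cast at hk; linarith)
    | succ m ih =>
      rcases lt_or_ge (N.toNat - m : ℤ) k with h | h
      · exact ih (by omega) h
      · refine hrigid k _ (fun n a ha => component_apply_mem D k ha)
          (isLocallyNilpotent_component D (by omega) (fun j hj => ih (by omega) (by omega))
            (conj_euler_bounded φ))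
  refine mem_of_proj_eq_zero fun m hm => ?_
  have h := component_apply (𝒜 := 𝒜) D (m - n) ha
  rw [add_sub_cancel] at h
  rw [← h]
  rcases lt_or_gt_of_ne hm with hm | hm
  · rw [hneg' (by omega), coe_zero, Pi.zero_apply]
  · rw [hpos N.toNat le_rfl (by omega), coe_zero, Pi.zero_apply]

end Graded

end Derivation

lemma prime_e8 : Prime (X 0 ^ 5 + X 1 ^ 3 + X 2 ^ 2 : MvPolynomial (Fin 3) ℂ) := by
  let e := (renameEquiv ℂ (Equiv.swap (0 : Fin 3) 2)).trans (finSuccEquiv ℂ 2)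
  let c : MvPolynomial (Fin 2) ℂ := X 1 ^ 5 + X 0 ^ 3
  have he : e (X 0 ^ 5 + X 1 ^ 3 + X 2 ^ 2) = Polynomial.X ^ 2 + Polynomial.C c := by
    have h0 : e (X 0) = Polynomial.C (X 1) := by
      simpa [e] using finSuccEquiv_X_succ (R := ℂ) (n := 2) (j := 1)
    have h1 : e (X 1) = Polynomial.C (X 0) := by
      have : Equiv.swap (0 : Fin 3) 2 1 = 1 := by decide
      simpa [e, this] using finSuccEquiv_X_succ (R := ℂ) (n := 2) (j := 0)
    have h2 : e (X 2) = Polynomial.X := by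
      simpa [e] using finSuccEquiv_X_zero (R := ℂ) (n := 2)
    simp only [map_add, map_pow, h0, h1, h2, c]
    ring
  rw [← MulEquiv.prime_iff e, he]
  have hdeg : (Polynomial.X ^ 2 + Polynomial.C c).natDegree = 2 :=
    Polynomial.natDegree_X_pow_add_C
  refine Irreducible.prime ?_
  rw [(Polynomial.monic_X_pow_add_C c two_ne_zero).irreducible_iff_roots_eq_zero_of_degree_le_three
    hdeg.ge (hdeg.le.trans (by norm_num)), Multiset.eq_zero_iff_forall_notMem]
  intro r hr
  have hr' : r ^ 2 + c = 0 := by simpa using Polynomial.isRoot_of_mem_roots hr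
  have h : (aeval ![0, Polynomial.X] r : Polynomial ℂ) ^ 2 = -Polynomial.X ^ 5 := by
    have := congrArg (aeval ![0, (Polynomial.X : Polynomial ℂ)]) hr'
    rw [← sub_eq_zero]
    simpa [c] using this
  have := congrArg Polynomial.natDegree h
  rw [Polynomial.natDegree_pow, Polynomial.natDegree_neg, Polynomial.natDegree_X_pow] at this
  omega

instance : IsDomain Ae8 :=
  have : Ie8.IsPrime := (Ideal.span_singleton_prime prime_e8.ne_zero).2 prime_e8
  Ideal.Quotient.isDomain Ie8

/-- A homogeneous polynomial of positive degree in two variables over an algebraically closed field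
has a linear factor. -/
lemma MvPolynomial.IsHomogeneous.exists_linear_dvd {K : Type*} [Field K] [IsAlgClosed K]
    {q : MvPolynomial (Fin 2) K} {n : ℕ} (hq : q.IsHomogeneous (n + 1)) :
    X 1 ∣ q ∨ ∃ r, X 0 - C r * X 1 ∣ q := by
  set p : Polynomial K := MvPolynomial.aeval ![Polynomial.X, 1] q
  have hpq : p.homogenize (n + 1) = q := Polynomial.homogenize_eq_of_isHomogeneous hq rfl
  have hdeg : p.natDegree ≤ n + 1 := by
    simpa using aeval_natDegree_le (m := n + 1) q hq.totalDegree_le ![Polynomial.X, 1] (n := 1)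
      (by simp [Fin.forall_fin_two])
  rcases Nat.lt_or_ge p.natDegree (n + 1) with h | h
  · left
    have := Polynomial.homogenize_mul p 1 (m := n) (n := 1) (by omega) (by simp)
    rw [mul_one, hpq] at this
    exact ⟨p.homogenize n, by simpa [mul_comm] using this⟩
  · right
    obtain ⟨r, hr⟩ := IsAlgClosed.exists_root p
      (by rw [Polynomial.degree_eq_natDegree (by rintro h0; simp [h0] at h)]
          exact_mod_cast (by omega : p.natDegree ≠ 0))
    obtain ⟨s, hs⟩ := Polynomial.dvd_iff_isRoot.2 hr
    have hs0 : s ≠ 0 := by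
      rintro rfl
      simp [hs] at h
    have hsdeg : s.natDegree ≤ n := by
      rw [hs, Polynomial.natDegree_mul (Polynomial.X_sub_C_ne_zero r) hs0,
        Polynomial.natDegree_X_sub_C] at hdeg
      omega
    have := Polynomial.homogenize_mul (Polynomial.X - Polynomial.C r) s (m := 1) (n := n)
      (by simp) hsdeg
    rw [← hs, add_comm 1 n, hpq] at this
    exact ⟨r, s.homogenize n, by simpa using this⟩

namespace Ae8

/-- The class of the first coordinate. -/
def x : Ae8 := Ideal.Quotient.mk Ie8 (X 0)

/-- The class of the second coordinate. -/
def y : Ae8 := Ideal.Quotient.mk Ie8 (X 1)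

/-- The class of the third coordinate. -/
def z : Ae8 := Ideal.Quotient.mk Ie8 (X 2)

lemma relation : x ^ 5 + y ^ 3 + z ^ 2 = 0 :=
  Ideal.Quotient.eq_zero_iff_mem.2 (Ideal.subset_span rfl)

section Lift

variable {B : Type*} [CommRing B] [Algebra ℂ B]

/-- The algebra homomorphism determined by a solution of `a⁵ + b³ + c² = 0`. -/
def lift (a b c : B) (h : a ^ 5 + b ^ 3 + c ^ 2 = 0) : Ae8 →ₐ[ℂ] B :=
  Ideal.Quotient.liftₐ Ie8 (aeval ![a, b, c]) fun p hp => by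
    obtain ⟨q, rfl⟩ := Ideal.mem_span_singleton.1 hp
    simp [h]

variable {a b c : B} (h : a ^ 5 + b ^ 3 + c ^ 2 = 0)

@[simp]
lemma lift_x : lift a b c h x = a := by
  change aeval ![a, b, c] (X 0 : MvPolynomial (Fin 3) ℂ) = a
  simp

@[simp]
lemma lift_y : lift a b c h y = b := by
  change aeval ![a, b, c] (X 1 : MvPolynomial (Fin 3) ℂ) = b
  simp

@[simp]
lemma lift_z : lift a b c h z = c := by
  change aeval ![a, b, c] (X 2 : MvPolynomial (Fin 3) ℂ) = c
  simp

lemma algHom_ext {f g : Ae8 →ₐ[ℂ] B} (hx : f x = g x) (hy : f y = g y) (hz : f z = g z) :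
    f = g := by
  refine Ideal.Quotient.algHom_ext ℂ (MvPolynomial.algHom_ext fun i => ?_)
  fin_cases i
  · exact hx
  · exact hy
  · exact hz

end Lift

lemma adjoin_eq_top : Algebra.adjoin ℂ {x, y, z} = ⊤ := by
  have h := congrArg (Subalgebra.map (Ideal.Quotient.mkₐ ℂ Ie8))
    (adjoin_range_X (R := ℂ) (σ := Fin 3))
  rw [AlgHom.map_adjoin, Algebra.map_top,
    (AlgHom.range_eq_top _).2 (Ideal.Quotient.mkₐ_surjective ℂ Ie8)] at h
  rw [← h]
  congr 1
  ext a
  simp [Fin.exists_fin_succ, x, y, z, eq_comm]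

/-- The classes of `x⁵`, `y³`, `z²` satisfy no linear relation but the obvious one. -/
lemma coeff_eq_of_relation {a b c : ℂ} (h : a • x ^ 5 + b • y ^ 3 + c • z ^ 2 = 0) :
    a = c ∧ b = c := by
  have hx := congrArg (lift (-1 : ℂ) 0 1 (by norm_num)) h
  have hy := congrArg (lift (0 : ℂ) (-1) 1 (by norm_num)) h
  simp only [map_add, map_smul, map_pow, lift_x, lift_y, lift_z, map_zero, smul_eq_mul] at hx hy
  exact ⟨by linear_combination -hx, by linear_combination -hy⟩

lemma x_ne_zero : x ≠ 0 := fun h => by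
  have := congrArg (lift (-1 : ℂ) 0 1 (by norm_num)) h
  simp at this

lemma y_ne_zero : y ≠ 0 := fun h => by
  have := congrArg (lift (0 : ℂ) (-1) 1 (by norm_num)) h
  simp at this

lemma z_ne_zero : z ≠ 0 := fun h => by
  have := congrArg (lift (-1 : ℂ) 0 1 (by norm_num)) h
  simp at this

/-- The piece of degree `n` of the grading in which `x`, `y`, `z` have degrees `6`, `10`, `15`. -/
def piece (n : ℤ) : Submodule ℂ Ae8 :=
  Submodule.span ℂ {a | ∃ i j k : ℕ, (6 * i + 10 * j + 15 * k : ℤ) = n ∧ a = x ^ i * y ^ j * z ^ k}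

lemma monomial_mem {n : ℤ} (i j k : ℕ) (h : (6 * i + 10 * j + 15 * k : ℤ) = n) :
    x ^ i * y ^ j * z ^ k ∈ piece n :=
  Submodule.subset_span ⟨i, j, k, h, rfl⟩

lemma x_mem : x ∈ piece 6 := by simpa using monomial_mem 1 0 0 rfl

lemma y_mem : y ∈ piece 10 := by simpa using monomial_mem 0 1 0 rfl

lemma z_mem : z ∈ piece 15 := by simpa using monomial_mem 0 0 1 rfl

lemma piece_eq_bot {n : ℤ} (h : ∀ i j k : ℕ, (6 * i + 10 * j + 15 * k : ℤ) ≠ n) : piece n = ⊥ := by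
  rw [piece, Submodule.span_eq_bot]
  rintro _ ⟨i, j, k, hn, -⟩
  exact absurd hn (h i j k)

lemma exists_smul_of_mem {n : ℤ} {i j k : ℕ}
    (h : ∀ i' j' k' : ℕ, (6 * i' + 10 * j' + 15 * k' : ℤ) = n → i' = i ∧ j' = j ∧ k' = k)
    {a : Ae8} (ha : a ∈ piece n) : ∃ c : ℂ, a = c • (x ^ i * y ^ j * z ^ k) := by
  have hle : piece n ≤ Submodule.span ℂ {x ^ i * y ^ j * z ^ k} := by
    refine Submodule.span_mono ?_
    rintro _ ⟨i', j', k', hn, rfl⟩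
    obtain ⟨rfl, rfl, rfl⟩ := h i' j' k' hn
    rfl
  obtain ⟨c, hc⟩ := Submodule.mem_span_singleton.1 (hle ha)
  exact ⟨c, hc.symm⟩

lemma exists_smul_x {a : Ae8} (ha : a ∈ piece 6) : ∃ c : ℂ, a = c • x := by
  simpa using exists_smul_of_mem (i := 1) (j := 0) (k := 0) (by omega) ha

lemma exists_smul_y {a : Ae8} (ha : a ∈ piece 10) : ∃ c : ℂ, a = c • y := by
  simpa using exists_smul_of_mem (i := 0) (j := 1) (k := 0) (by omega) ha

lemma exists_smul_z {a : Ae8} (ha : a ∈ piece 15) : ∃ c : ℂ, a = c • z := by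
  simpa using exists_smul_of_mem (i := 0) (j := 0) (k := 1) (by omega) ha

instance : SetLike.GradedMonoid piece where
  one_mem := by simpa using monomial_mem 0 0 0 rfl
  mul_mem := by
    intro m n a b ha hb
    have hle : piece m * piece n ≤ piece (m + n) := by
      rw [piece, piece, Submodule.span_mul_span, Submodule.span_le]
      rintro _ ⟨_, ⟨i, j, k, rfl, rfl⟩, _, ⟨i', j', k', rfl, rfl⟩, rfl⟩
      have h := monomial_mem (n := 6 * i + 10 * j + 15 * k + (6 * i' + 10 * j' + 15 * k'))
        (i + i') (j + j') (k + k') (by push_cast; ring)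
      have hmul : x ^ (i + i') * y ^ (j + j') * z ^ (k + k') =
          x ^ i * y ^ j * z ^ k * (x ^ i' * y ^ j' * z ^ k') := by ring
      rwa [hmul] at h
    exact hle (Submodule.mul_mem_mul ha hb)

open DirectSum in
/-- The decomposition of an element into its homogeneous components. -/
def decomposeHom : Ae8 →ₐ[ℂ] ⨁ n, piece n :=
  lift (of (fun n => piece n) 6 ⟨x, x_mem⟩) (of (fun n => piece n) 10 ⟨y, y_mem⟩)
    (of (fun n => piece n) 15 ⟨z, z_mem⟩) <| by
    have hx : of (fun n => piece n) 6 ⟨x, x_mem⟩ ^ 5 =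
        of (fun n => piece n) 30 ⟨x ^ 5, SetLike.pow_mem_graded 5 x_mem⟩ := by
      rw [ofPow]; rfl
    have hy : of (fun n => piece n) 10 ⟨y, y_mem⟩ ^ 3 =
        of (fun n => piece n) 30 ⟨y ^ 3, SetLike.pow_mem_graded 3 y_mem⟩ := by
      rw [ofPow]; rfl
    have hz : of (fun n => piece n) 15 ⟨z, z_mem⟩ ^ 2 =
        of (fun n => piece n) 30 ⟨z ^ 2, SetLike.pow_mem_graded 2 z_mem⟩ := by
      rw [ofPow]; rfl
    rw [hx, hy, hz, ← map_add, ← map_add]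
    exact (congrArg _ (Subtype.ext relation)).trans (map_zero (of (fun n => piece n) 30))

open DirectSum in
lemma decomposeHom_monomial (i j k : ℕ) :
    decomposeHom (x ^ i * y ^ j * z ^ k) =
      of (fun n => piece n) (6 * i + 10 * j + 15 * k) ⟨_, monomial_mem i j k rfl⟩ := by
  simp only [decomposeHom, map_mul, map_pow, lift_x, lift_y, lift_z, ofPow, of_mul_of]
  refine of_eq_of_gradedMonoid_eq (Sigma.subtype_ext ?_ ?_)
  · change i • (6 : ℤ) + j • (10 : ℤ) + k • (15 : ℤ) = 6 * i + 10 * j + 15 * k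
    simp only [nsmul_eq_mul]
    ring
  · rfl

open DirectSum in
instance : GradedAlgebra piece :=
  GradedAlgebra.ofAlgHom piece decomposeHom
    (by apply algHom_ext <;> simp [decomposeHom]) <| by
    rintro n ⟨a, ha⟩
    simp only
    induction ha using Submodule.span_induction with
    | mem a h =>
      obtain ⟨i, j, k, rfl, rfl⟩ := h
      exact decomposeHom_monomial i j k
    | zero => exact (map_zero _).trans (map_zero _).symm
    | add a b ha hb iha ihb =>
      rw [map_add, iha, ihb, ← map_add]
      rfl
    | smul c a ha iha =>
      rw [_root_.map_smul, iha, ← lof_eq_of ℂ, ← lof_eq_of ℂ, ← _root_.map_smul]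
      rfl

lemma smul_eq_algebraMap_mul (c : ℂ) (a : Ae8) : c • a = algebraMap ℂ Ae8 c * a :=
  Algebra.smul_def c a

lemma piece_of_neg {n : ℤ} (hn : n < 0) : piece n = ⊥ :=
  piece_eq_bot (by omega)

/-- A homogeneous element is a monomial times a binary form in `x⁵` and `y³`. -/
lemma exists_eq_mul_aeval {n : ℤ} {a : Ae8} (ha : a ∈ piece n) (ha0 : a ≠ 0) :
    ∃ (i j k l : ℕ) (q : MvPolynomial (Fin 2) ℂ), (6 * i + 10 * j + 15 * k + 30 * l : ℤ) = n ∧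
      q.IsHomogeneous l ∧ a = x ^ i * y ^ j * z ^ k * aeval ![x ^ 5, y ^ 3] q := by
  obtain ⟨i, j, k, hn⟩ : ∃ i j k : ℕ, (6 * i + 10 * j + 15 * k : ℤ) = n := by
    by_contra! h
    rw [piece_eq_bot h, Submodule.mem_bot] at ha
    exact ha0 ha
  let f : MvPolynomial (Fin 2) ℂ →ₗ[ℂ] Ae8 :=
    LinearMap.mulLeft ℂ (x ^ (i % 5) * y ^ (j % 3) * z ^ (k % 2)) ∘ₗ
      (aeval ![x ^ 5, y ^ 3]).toLinearMap
  have hle : piece n ≤ (homogeneousSubmodule (Fin 2) ℂ (i / 5 + j / 3 + k / 2)).map f := by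
    refine Submodule.span_le.2 ?_
    rintro _ ⟨i', j', k', hn', rfl⟩
    have hi : i' % 5 = i % 5 := by omega
    have hj : j' % 3 = j % 3 := by omega
    have hk : k' % 2 = k % 2 := by omega
    have hl : i' / 5 + j' / 3 + k' / 2 = i / 5 + j / 3 + k / 2 := by omega
    refine ⟨X 0 ^ (i' / 5) * X 1 ^ (j' / 3) * (-(X 0 + X 1)) ^ (k' / 2), ?_, ?_⟩
    · have h (m : Fin 2) : (X m : MvPolynomial (Fin 2) ℂ).IsHomogeneous 1 := isHomogeneous_X _ _
      have := (((h 0).pow (i' / 5)).mul ((h 1).pow (j' / 3))).mul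
        (((h 0).add (h 1)).neg.pow (k' / 2))
      simp only [one_mul, hl] at this
      exact this
    · have hz : z ^ 2 = -(x ^ 5 + y ^ 3) := by linear_combination relation
      simp only [f, LinearMap.comp_apply, LinearMap.mulLeft_apply, AlgHom.toLinearMap_apply,
        map_mul, map_pow, map_neg, map_add, aeval_X, Matrix.cons_val_zero, Matrix.cons_val_one,
        ← hz, ← hi, ← hj, ← hk]
      conv_rhs => rw [← Nat.mod_add_div i' 5, ← Nat.mod_add_div j' 3, ← Nat.mod_add_div k' 2]
      ring
  obtain ⟨q, hq, rfl⟩ := hle ha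
  exact ⟨i % 5, j % 3, k % 2, i / 5 + j / 3 + k / 2, q, by omega, hq, rfl⟩

lemma derivation_ext {D : Derivation ℂ Ae8 Ae8} (hx : D x = 0) (hy : D y = 0) (hz : D z = 0) :
    D = 0 := by
  refine Derivation.ext_of_adjoin_eq_top _ adjoin_eq_top ?_
  rintro a (rfl | rfl | rfl)
  · exact hx
  · exact hy
  · exact hz

lemma derivation_relation (D : Derivation ℂ Ae8 Ae8) :
    5 * (x ^ 4 * D x) + 3 * (y ^ 2 * D y) + 2 * (z * D z) = 0 := by
  have := congrArg D relation
  simpa [Derivation.leibniz_pow] using this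

section Rigid

variable {D : Derivation ℂ Ae8 Ae8}

lemma eq_zero_of_apply_x_y (hx : D x = 0) (hy : D y = 0) : D = 0 := by
  refine derivation_ext hx hy ?_
  have h := derivation_relation D
  rw [hx, hy, mul_zero, mul_zero, mul_zero, mul_zero, zero_add, zero_add] at h
  have : CharZero Ae8 := charZero_of_injective_algebraMap (algebraMap ℂ Ae8).injective
  exact (mul_eq_zero.1 ((mul_eq_zero.1 h).resolve_left two_ne_zero)).resolve_left z_ne_zero

lemma eq_zero_of_apply_x (hD : D.IsLocallyNilpotent) (hx : D x = 0) : D = 0 := by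
  have he : y ^ (1 + 2) + (1 : ℂ) • z ^ (0 + 2) = -x ^ 5 := by
    rw [one_smul]
    linear_combination relation
  obtain ⟨hy, -⟩ := hD.apply_eq_zero_of_binomial one_ne_zero
    (he ▸ neg_ne_zero.2 (pow_ne_zero 5 x_ne_zero)) (he ▸ by simp [Derivation.leibniz_pow, hx])
  exact eq_zero_of_apply_x_y hx hy

lemma eq_zero_of_apply_y (hD : D.IsLocallyNilpotent) (hy : D y = 0) : D = 0 := by
  have he : x ^ (3 + 2) + (1 : ℂ) • z ^ (0 + 2) = -y ^ 3 := by
    rw [one_smul]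
    linear_combination relation
  obtain ⟨hx, -⟩ := hD.apply_eq_zero_of_binomial one_ne_zero
    (he ▸ neg_ne_zero.2 (pow_ne_zero 3 y_ne_zero)) (he ▸ by simp [Derivation.leibniz_pow, hy])
  exact eq_zero_of_apply_x_y hx hy

lemma eq_zero_of_apply_z (hD : D.IsLocallyNilpotent) (hz : D z = 0) : D = 0 := by
  have he : x ^ (3 + 2) + (1 : ℂ) • y ^ (1 + 2) = -z ^ 2 := by
    rw [one_smul]
    linear_combination relation
  obtain ⟨hx, hy⟩ := hD.apply_eq_zero_of_binomial one_ne_zero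
    (he ▸ neg_ne_zero.2 (pow_ne_zero 2 z_ne_zero)) (he ▸ by simp [Derivation.leibniz_pow, hz])
  exact eq_zero_of_apply_x_y hx hy

lemma eq_zero_of_apply_homogeneous (hD : D.IsLocallyNilpotent) {n : ℤ} (hn : n ≠ 0)
    {a : Ae8} (ha : a ∈ piece n) (ha0 : a ≠ 0) (hDa : D a = 0) : D = 0 := by
  obtain ⟨i, j, k, l, q, hsum, hq, rfl⟩ := exists_eq_mul_aeval ha ha0
  have hker {b : Ae8} (hb : b ∣ x ^ i * y ^ j * z ^ k * aeval ![x ^ 5, y ^ 3] q) : D b = 0 :=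
    hD.apply_eq_zero_of_dvd hb ha0 hDa
  rcases Nat.eq_zero_or_pos i with rfl | hi
  swap
  · exact eq_zero_of_apply_x hD
      (hker ((((dvd_pow_self x hi.ne').mul_right _).mul_right _).mul_right _))
  rcases Nat.eq_zero_or_pos j with rfl | hj
  swap
  · exact eq_zero_of_apply_y hD
      (hker ((((dvd_pow_self y hj.ne').mul_left _).mul_right _).mul_right _))
  rcases Nat.eq_zero_or_pos k with rfl | hk
  swap
  · exact eq_zero_of_apply_z hD (hker (((dvd_pow_self z hk.ne').mul_left _).mul_right _))
  obtain ⟨l, rfl⟩ : ∃ m, l = m + 1 :=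
    Nat.exists_eq_succ_of_ne_zero (by rintro rfl; simp at hsum; omega)
  rcases hq.exists_linear_dvd with h | ⟨r, h⟩
  · have h' := (map_dvd (aeval ![x ^ 5, y ^ 3]) h).mul_left (x ^ 0 * y ^ 0 * z ^ 0)
    rw [aeval_X] at h'
    exact eq_zero_of_apply_y hD (hker ((dvd_pow_self y three_ne_zero).trans h'))
  · have h' := (map_dvd (aeval ![x ^ 5, y ^ 3]) h).mul_left (x ^ 0 * y ^ 0 * z ^ 0)
    have he : aeval ![x ^ 5, y ^ 3] (X 0 - C r * X 1 : MvPolynomial (Fin 2) ℂ) =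
        x ^ (3 + 2) + (-r) • y ^ (1 + 2) := by
      simp [smul_eq_algebraMap_mul, sub_eq_add_neg]
    rw [he] at h'
    rcases eq_or_ne r 0 with rfl | hr
    · rw [neg_zero, zero_smul, add_zero] at h'
      exact eq_zero_of_apply_x hD (hker ((dvd_pow_self x (by norm_num)).trans h'))
    · obtain ⟨hx, hy⟩ := hD.apply_eq_zero_of_binomial (neg_ne_zero.2 hr)
        (ne_zero_of_dvd_ne_zero ha0 h') (hker h')
      exact eq_zero_of_apply_x_y hx hy

/-- The algebra has no nontrivial homogeneous locally nilpotent derivations. -/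
lemma eq_zero_of_isLocallyNilpotent (hD : D.IsLocallyNilpotent) {k : ℤ}
    (hk : ∀ n, ∀ a ∈ piece n, D a ∈ piece (n + k)) : D = 0 := by
  rcases lt_or_ge k 0 with hneg | hpos
  · have hx := hk 6 x x_mem
    rcases eq_or_ne k (-6) with rfl | h6
    · have hy := hk 10 y y_mem
      rw [piece_eq_bot (by omega), Submodule.mem_bot] at hy
      exact eq_zero_of_apply_y hD hy
    · rw [piece_eq_bot fun i j k => by rcases i <;> rcases j <;> rcases k <;> omega,
        Submodule.mem_bot] at hx
      exact eq_zero_of_apply_x hD hx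
  · obtain ⟨m, hm, hm'⟩ := hD.exists_hasNilDegree x_ne_zero
    have hmem (m : ℕ) : D^[m] x ∈ piece (6 + m * k) := by
      induction m with
      | zero => simpa using x_mem
      | succ m ih =>
        rw [Function.iterate_succ_apply']
        convert hk _ _ ih using 2
        push_cast
        ring
    rw [Function.iterate_succ_apply'] at hm'
    refine eq_zero_of_apply_homogeneous hD ?_ (hmem m) hm hm'
    positivity

end Rigid

lemma euler_conj_mem (φ : Ae8 ≃ₐ[ℂ] Ae8) {n : ℤ} {a : Ae8} (ha : a ∈ piece n) :
    Derivation.conj φ (Derivation.euler piece) a ∈ piece n := by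
  refine Derivation.conj_euler_apply_mem (fun n hn => piece_of_neg hn)
    (fun k D hk hD => eq_zero_of_isLocallyNilpotent hD hk) (s := {x, y, z}) (by simp)
    adjoin_eq_top ?_ φ ha
  rintro a (rfl | rfl | rfl)
  exacts [⟨6, x_mem⟩, ⟨10, y_mem⟩, ⟨15, z_mem⟩]

/-- An automorphism multiplies degrees by a constant. -/
lemma exists_map_mem (φ : Ae8 ≃ₐ[ℂ] Ae8) :
    ∃ k : ℤ, 0 ≤ k ∧ ∀ n, ∀ a ∈ piece n, φ a ∈ piece (k * n) := by
  set D := Derivation.conj φ.symm (Derivation.euler piece) with hD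
  have heig {a : Ae8} {c : ℂ} (ha : a ≠ 0) (h : D a = c • a) : ∃ n : ℤ, c = n ∧ φ a ∈ piece n := by
    refine Derivation.exists_mem_of_euler_apply_eq ((map_ne_zero_iff φ φ.injective).2 ha) ?_
    rw [← map_smul, ← h, hD, Derivation.conj_apply, AlgEquiv.symm_symm, AlgEquiv.apply_symm_apply]
  obtain ⟨a, ha⟩ := exists_smul_x (euler_conj_mem φ.symm x_mem)
  obtain ⟨b, hb⟩ := exists_smul_y (euler_conj_mem φ.symm y_mem)
  obtain ⟨c, hc⟩ := exists_smul_z (euler_conj_mem φ.symm z_mem)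
  rw [← hD] at ha hb hc
  obtain ⟨p, rfl, hp⟩ := heig x_ne_zero ha
  obtain ⟨q, rfl, hq⟩ := heig y_ne_zero hb
  obtain ⟨r, rfl, hr⟩ := heig z_ne_zero hc
  have hrel : (5 * p : ℂ) • x ^ 5 + (3 * q : ℂ) • y ^ 3 + (2 * r : ℂ) • z ^ 2 = 0 := by
    have h := derivation_relation D
    rw [ha, hb, hc] at h
    simp only [smul_eq_algebraMap_mul, map_mul, map_ofNat] at h ⊢
    linear_combination h
  obtain ⟨h₁, h₂⟩ := coeff_eq_of_relation hrel
  have h₁' : 5 * p = 2 * r := by exact_mod_cast h₁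
  have h₂' : 3 * q = 2 * r := by exact_mod_cast h₂
  obtain ⟨k, rfl⟩ : ∃ k, p = k * 6 := ⟨p / 6, by omega⟩
  obtain rfl : q = k * 10 := by omega
  obtain rfl : r = k * 15 := by omega
  refine ⟨k, ?_, fun n a ha => ?_⟩
  · by_contra! hk
    rw [piece_of_neg (by omega), Submodule.mem_bot] at hp
    exact (map_ne_zero_iff φ φ.injective).2 x_ne_zero hp
  · induction ha using Submodule.span_induction with
    | mem a h =>
      obtain ⟨i, j, m, rfl, rfl⟩ := h
      rw [map_mul, map_mul, map_pow, map_pow, map_pow]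
      convert SetLike.mul_mem_graded (SetLike.mul_mem_graded (SetLike.pow_mem_graded i hp)
        (SetLike.pow_mem_graded j hq)) (SetLike.pow_mem_graded m hr) using 2
      simp only [nsmul_eq_mul]
      ring
    | zero => rw [map_zero]; exact zero_mem _
    | add a b _ _ ha hb => rw [map_add]; exact add_mem ha hb
    | smul c a _ ha => rw [map_smul]; exact Submodule.smul_mem _ c ha

lemma map_mem (φ : Ae8 ≃ₐ[ℂ] Ae8) {n : ℤ} {a : Ae8} (ha : a ∈ piece n) : φ a ∈ piece n := by
  obtain ⟨k, hk, hφ⟩ := exists_map_mem φ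
  obtain ⟨l, -, hφ'⟩ := exists_map_mem φ.symm
  have h := hφ' _ _ (hφ _ _ x_mem)
  rw [AlgEquiv.symm_apply_apply] at h
  have hlk : l * (k * 6) = 6 := DirectSum.degree_eq_of_mem_mem piece h x_mem x_ne_zero
  have hk1 : k = 1 := Int.eq_one_of_mul_eq_one_left hk (by linarith : l * k = 1)
  simpa [hk1] using hφ n a ha

/-- Every automorphism is diagonal. -/
lemma exists_diagonal (φ : Ae8 ≃ₐ[ℂ] Ae8) :
    ∃ t : ℂˣ, φ x = (t : ℂ) ^ 6 • x ∧ φ y = (t : ℂ) ^ 10 • y ∧ φ z = (t : ℂ) ^ 15 • z := by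
  obtain ⟨a, ha⟩ := exists_smul_x (map_mem φ x_mem)
  obtain ⟨b, hb⟩ := exists_smul_y (map_mem φ y_mem)
  obtain ⟨c, hc⟩ := exists_smul_z (map_mem φ z_mem)
  have hne {u : Ae8} {d : ℂ} (hu : u ≠ 0) (h : φ u = d • u) : d ≠ 0 := by
    rintro rfl
    rw [zero_smul, map_eq_zero_iff φ φ.injective] at h
    exact hu h
  have ha0 := hne x_ne_zero ha
  have hb0 := hne y_ne_zero hb
  have hc0 := hne z_ne_zero hc
  have hrel := congrArg φ relation
  simp only [map_add, map_pow, map_zero, ha, hb, hc, smul_pow] at hrel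
  obtain ⟨h₁, h₂⟩ := coeff_eq_of_relation hrel
  refine ⟨Units.mk0 (a * b / c) (by positivity), ?_⟩
  have hx : (a * b / c) ^ 6 = a := by
    rw [div_pow, div_eq_iff (by positivity)]
    have : c ^ 6 = a ^ 5 * b ^ 6 := by
      linear_combination (-c ^ 4) * h₁ - a ^ 5 * (b ^ 3 + c ^ 2) * h₂
    rw [this]
    ring
  have hy : (a * b / c) ^ 10 = b := by
    rw [div_pow, div_eq_iff (by positivity)]
    have : c ^ 10 = a ^ 10 * b ^ 9 := by
      rw [show a ^ 10 = (a ^ 5) ^ 2 by ring, show b ^ 9 = (b ^ 3) ^ 3 by ring, h₁, h₂]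
      ring
    rw [this]
    ring
  have hz : (a * b / c) ^ 15 = c := by
    rw [div_pow, div_eq_iff (by positivity), mul_pow,
      show a ^ 15 = (a ^ 5) ^ 3 by ring, show b ^ 15 = (b ^ 3) ^ 5 by ring, h₁, h₂]
    ring
  rw [Units.val_mk0, hx, hy, hz]
  exact ⟨ha, hb, hc⟩

/-- The diagonal endomorphism with weights `6`, `10`, `15`. -/
def scale (t : ℂ) : Ae8 →ₐ[ℂ] Ae8 :=
  lift (t ^ 6 • x) (t ^ 10 • y) (t ^ 15 • z) <| by
    rw [smul_pow, smul_pow, smul_pow, ← pow_mul, ← pow_mul, ← pow_mul, ← smul_add, ← smul_add,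
      relation, smul_zero]

lemma scale_comp (s t : ℂ) : (scale s).comp (scale t) = scale (s * t) := by
  apply algHom_ext <;> simp [scale, smul_smul, mul_pow, mul_comm]

lemma scale_one : scale 1 = AlgHom.id ℂ Ae8 := by
  apply algHom_ext <;> simp [scale]

/-- The action of `ℂˣ` by diagonal automorphisms. -/
def torus : ℂˣ →* (Ae8 ≃ₐ[ℂ] Ae8) where
  toFun t := AlgEquiv.ofAlgHom (scale t) (scale ↑t⁻¹) (by simp [scale_comp, scale_one])
    (by simp [scale_comp, scale_one])
  map_one' := AlgEquiv.ext fun a => DFunLike.congr_fun scale_one a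
  map_mul' s t := AlgEquiv.ext fun a => (DFunLike.congr_fun (scale_comp s t) a).symm

lemma torus_apply_x (t : ℂˣ) : torus t x = (t : ℂ) ^ 6 • x := by
  change scale t x = _
  simp [scale]

lemma torus_apply_y (t : ℂˣ) : torus t y = (t : ℂ) ^ 10 • y := by
  change scale t y = _
  simp [scale]

lemma torus_apply_z (t : ℂˣ) : torus t z = (t : ℂ) ^ 15 • z := by
  change scale t z = _
  simp [scale]

lemma torus_injective : Function.Injective torus := by
  refine (injective_iff_map_eq_one torus).2 fun t ht => ?_
  have hx := torus_apply_x t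
  have hy := torus_apply_y t
  have hz := torus_apply_z t
  rw [ht, AlgEquiv.one_apply] at hx hy hz
  have hone {u : Ae8} {d : ℂ} (hu : u ≠ 0) (h : u = d • u) : d = 1 :=
    smul_left_injective ℂ hu (by simpa using h.symm)
  have h₆ := hone x_ne_zero hx
  have h₁₀ := hone y_ne_zero hy
  have h₁₅ := hone z_ne_zero hz
  refine Units.ext ?_
  have : (t : ℂ) * (t : ℂ) ^ 15 = (t : ℂ) ^ 6 * (t : ℂ) ^ 10 := by ring
  simpa [h₆, h₁₀, h₁₅] using this

lemma torus_surjective : Function.Surjective torus := fun φ => by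
  obtain ⟨t, hx, hy, hz⟩ := exists_diagonal φ
  refine ⟨t, AlgEquiv.coe_toAlgHom_injective (algHom_ext ?_ ?_ ?_)⟩
  · exact (torus_apply_x t).trans hx.symm
  · exact (torus_apply_y t).trans hy.symm
  · exact (torus_apply_z t).trans hz.symm

end Ae8

/-- Aut(A) ≅ ℂ*, via t ↦ (x ↦ t^6 x, y ↦ t^10 y, z ↦ t^15 z). -/
theorem e8_aut_group :
    ∃ e : ℂˣ ≃* (Ae8 ≃ₐ[ℂ] Ae8),
      ∀ t : ℂˣ,
        e t (Ideal.Quotient.mk Ie8 (X 0)) =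
          ((t : ℂ) ^ 6) • Ideal.Quotient.mk Ie8 (X 0) ∧
        e t (Ideal.Quotient.mk Ie8 (X 1)) =
          ((t : ℂ) ^ 10) • Ideal.Quotient.mk Ie8 (X 1) ∧
        e t (Ideal.Quotient.mk Ie8 (X 2)) =
          ((t : ℂ) ^ 15) • Ideal.Quotient.mk Ie8 (X 2) :=
  ⟨MulEquiv.ofBijective Ae8.torus ⟨Ae8.torus_injective, Ae8.torus_surjective⟩, fun t =>
    ⟨Ae8.torus_apply_x t, Ae8.torus_apply_y t, Ae8.torus_apply_z t⟩⟩

end
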